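/- Fix an integer r ≥ 1 and positive integers l_1, ..., l_r. For every real ε > 0 there exists N such that for all integers n_1, ..., n_r with 1 < n_1 | n_2 | ... | n_r, ω(n_i) = l_i for every i, gcd(n_i, n_r/n_i) = 1 for every i, and P^-(n_r) ≥ N, one has |k(C_{n_1} ⊕ ... ⊕ C_{n_r}) − Σ_{i=1}^r l_i| < ε. -/

import Mathlib

open scoped BigOperators

attribute [local instance] Classical.propDecidable

/-- A sequence (multiset) over `G` is zero-sumfree if no nonempty sub-multiset sums to `0`. -/
def IsZeroSumFree {G : Type*} [AddCommGroup G] (S : Multiset G) : Prop :=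
  ∀ T : Multiset G, T ≤ S → T ≠ 0 → T.sum ≠ 0

/-- A minimal zero-sum sequence: sum `0`, and no nonempty proper sub-multiset sums to `0`. -/
def IsMinimalZeroSum {G : Type*} [AddCommGroup G] (S : Multiset G) : Prop :=
  S.sum = 0 ∧ ∀ T : Multiset G, T < S → T ≠ 0 → T.sum ≠ 0

/-- The cross number of a sequence: `k(S) = Σ_{g ∈ S} 1/ord(g)`. -/
noncomputable def crossNumber {G : Type*} [AddCommGroup G] (S : Multiset G) : ℝ :=
  (S.map fun g => (1 : ℝ) / (addOrderOf g)).sum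

/-- The little cross number `k(G)`: max of `k(S)` over zero-sumfree sequences `S` over `G`. -/
noncomputable def littleCrossNumber (G : Type*) [AddCommGroup G] : ℝ :=
  sSup {x : ℝ | ∃ S : Multiset G, IsZeroSumFree S ∧ crossNumber S = x}

/-- The cross number `K(G)`: max of `k(S)` over minimal zero-sum sequences `S` over `G`. -/
noncomputable def bigCrossNumber (G : Type*) [AddCommGroup G] : ℝ :=
  sSup {x : ℝ | ∃ S : Multiset G, IsMinimalZeroSum S ∧ crossNumber S = x}

/-- The Davenport constant `D(G)`. -/
noncomputable def davenport (G : Type*) [AddCommGroup G] : ℕ :=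
  sInf {t | 1 ≤ t ∧ ∀ S : Multiset G, t ≤ Multiset.card S →
    ∃ T, T ≤ S ∧ T ≠ 0 ∧ T.sum = 0}

/-- The constant `η(G)`. -/
noncomputable def etaConst (G : Type*) [AddCommGroup G] : ℕ :=
  sInf {t | 1 ≤ t ∧ ∀ S : Multiset G, t ≤ Multiset.card S →
    ∃ T, T ≤ S ∧ T ≠ 0 ∧ Multiset.card T ≤ AddMonoid.exponent G ∧ T.sum = 0}

/-- `υ_i(d',d) = A_i / gcd(A_i, B_i)` where `A_i = gcd(d', n_i)` and
`B_i = lcm(d, n_i)/lcm(d', n_i)`. -/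
def upsilon (ni d' d : ℕ) : ℕ :=
  Nat.gcd d' ni / Nat.gcd (Nat.gcd d' ni) (Nat.lcm d ni / Nat.lcm d' ni)

/-- `k*` of `C_{n_1} ⊕ ... ⊕ C_{n_r}`, computed from the primary decomposition. -/
noncomputable def kStarTuple {r : ℕ} (n : Fin r → ℕ) : ℝ :=
  ∑ i, ∑ p ∈ (n i).primeFactors,
    ((p ^ ((n i).factorization p) : ℝ) - 1) / (p ^ ((n i).factorization p))

/-- `α(n) = Σ_{d | n} (P⁻(d) − 1)/d`. -/
noncomputable def alphaFn (n : ℕ) : ℝ :=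
  ∑ d ∈ n.divisors, ((d.minFac : ℝ) - 1) / d

/-- `β(n) = Σ_{p | n prime} (p − 1)/p`. -/
noncomputable def betaFn (n : ℕ) : ℝ :=
  ∑ p ∈ n.primeFactors, ((p : ℝ) - 1) / p

section Expansion

/-- The number of points of `Y` that translation by `d` moves out of `Y`. -/
noncomputable def escapeCard {V : Type*} [AddCommGroup V] (Y : Finset V) (d : V) : ℕ :=
  (Y.filter fun y => y + d ∉ Y).card

theorem escapeCard_add_le {V : Type*} [AddCommGroup V] (Y : Finset V) (a b : V) :
    escapeCard Y (a + b) ≤ escapeCard Y a + escapeCard Y b := by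
  unfold escapeCard
  have hsub : (Y.filter fun y => y + (a + b) ∉ Y) ⊆
      (Y.filter fun y => y + a ∉ Y) ∪ ((Y.filter fun y => y + b ∉ Y).image fun y => y - a) := by
    intro y hy
    rw [Finset.mem_filter] at hy
    by_cases h : y + a ∈ Y
    · refine Finset.mem_union_right _ (Finset.mem_image.2 ⟨y + a, ?_, by abel⟩)
      rw [Finset.mem_filter, add_assoc]
      exact ⟨h, hy.2⟩
    · exact Finset.mem_union_left _ (Finset.mem_filter.2 ⟨hy.1, h⟩)
  refine (Finset.card_le_card hsub).trans ((Finset.card_union_le _ _).trans ?_)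
  exact Nat.add_le_add_left Finset.card_image_le _

theorem escapeCard_two_pow_nsmul_le {V : Type*} [AddCommGroup V] (Y : Finset V) (d : V) (j : ℕ) :
    escapeCard Y (2 ^ j • d) ≤ 2 ^ j * escapeCard Y d := by
  induction j with
  | zero => simp
  | succ j ih =>
    rw [pow_succ, mul_nsmul, two_nsmul]
    have := escapeCard_add_le Y (2 ^ j • d) (2 ^ j • d)
    linarith

theorem re_stdAddChar_intCast {p : ℕ} [NeZero p] (k : ℤ) :
    (ZMod.stdAddChar (k : ZMod p)).re = Real.cos (2 * Real.pi * k / p) := by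
  rw [ZMod.stdAddChar_coe]
  have : (2 * (Real.pi : ℂ) * Complex.I * k / p) = ((2 * Real.pi * k / p : ℝ) : ℂ) * Complex.I := by
    push_cast
    ring
  rw [this, Complex.exp_ofReal_mul_I_re]

theorem re_stdAddChar_le_one {p : ℕ} [NeZero p] (u : ZMod p) :
    (ZMod.stdAddChar u).re ≤ 1 := by
  obtain ⟨k, rfl⟩ := ZMod.intCast_surjective u
  rw [re_stdAddChar_intCast]
  exact Real.cos_le_one _

/-- The dyadic dilates of a residue detect its absolute value. -/
theorem natAbs_valMinAbs_le_sum_dyadic {p : ℕ} [NeZero p] {J : ℕ} (hJ : p ≤ 2 ^ J) (u : ZMod p) :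
    (2 : ℝ) * u.valMinAbs.natAbs ≤
      p * ∑ j ∈ Finset.range J, (1 - (ZMod.stdAddChar ((2 ^ j : ℕ) • u)).re) / 2 ^ j := by
  have hp : 0 < p := Nat.pos_of_ne_zero (NeZero.ne p)
  have hnn : ∀ j ∈ Finset.range J,
      0 ≤ (1 - (ZMod.stdAddChar ((2 ^ j : ℕ) • u)).re) / 2 ^ j := fun j _ =>
    div_nonneg (sub_nonneg.2 (re_stdAddChar_le_one _)) (by positivity)
  set s := u.valMinAbs.natAbs with hs
  rcases Nat.eq_zero_or_pos s with h0 | hpos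
  · rw [h0]
    simpa using mul_nonneg (Nat.cast_nonneg p) (Finset.sum_nonneg hnn)
  have hle : 2 * s ≤ p := by
    have := ZMod.valMinAbs_mem_Ioc u
    rw [Set.mem_Ioc] at this
    omega
  set j := Nat.log 2 (p / (2 * s)) with hj
  have hq : p / (2 * s) ≠ 0 := (Nat.div_pos hle (by omega)).ne'
  have h1 : 2 ^ j * (2 * s) ≤ p :=
    (Nat.le_div_iff_mul_le (by omega)).1 (Nat.pow_log_le_self 2 hq)
  have h2 : p < 2 ^ (j + 1) * (2 * s) :=
    (Nat.div_lt_iff_lt_mul (by omega)).1 (Nat.lt_pow_succ_log_self (by norm_num) _)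
  have hjJ : j < J := by
    have : 2 ^ j < 2 ^ J := by nlinarith [Nat.pos_of_ne_zero (pow_ne_zero j (two_ne_zero' ℕ))]
    exact (Nat.pow_lt_pow_iff_right (by norm_num)).1 this
  have hre : (ZMod.stdAddChar ((2 ^ j : ℕ) • u)).re ≤ 0 := by
    have hcast : ((2 ^ j : ℕ) • u) = (((2 ^ j : ℕ) * u.valMinAbs : ℤ) : ZMod p) := by
      push_cast
      simp
    rw [hcast, re_stdAddChar_intCast, ← Real.cos_abs]
    have hpR : (0 : ℝ) < p := by exact_mod_cast hp
    have habs : |2 * Real.pi * (((2 ^ j : ℕ) * u.valMinAbs : ℤ) : ℝ) / p| =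
        Real.pi * (2 ^ j * (2 * s)) / p := by
      rw [abs_div, abs_mul, abs_of_pos (by positivity : (0 : ℝ) < 2 * Real.pi), abs_of_pos hpR]
      push_cast
      rw [abs_mul, abs_of_pos (by positivity : (0 : ℝ) < 2 ^ j), hs, Nat.cast_natAbs]
      push_cast
      ring
    rw [habs]
    have h1' : (2 : ℝ) ^ j * (2 * s) ≤ p := by exact_mod_cast h1
    have h2' : (p : ℝ) < 2 ^ (j + 1) * (2 * s) := by exact_mod_cast h2
    rw [pow_succ] at h2'
    apply Real.cos_nonpos_of_pi_div_two_le_of_le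
    · rw [div_le_div_iff₀ (by norm_num) hpR]
      nlinarith [Real.pi_pos]
    · rw [div_le_iff₀ hpR]
      nlinarith [Real.pi_pos, mul_le_mul_of_nonneg_left h1' Real.pi_pos.le]
  have hterm := Finset.single_le_sum hnn (Finset.mem_range.2 hjJ)
  have h1' : (2 : ℝ) ^ j * (2 * s) ≤ p := by exact_mod_cast h1
  have hone : (1 : ℝ) / 2 ^ j ≤ (1 - (ZMod.stdAddChar ((2 ^ j : ℕ) • u)).re) / 2 ^ j := by
    gcongr
    linarith
  calc (2 : ℝ) * s ≤ p * (1 / 2 ^ j) := by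
        rw [mul_one_div, le_div_iff₀ (by positivity)]
        linarith
    _ ≤ _ := by
        gcongr
        exact hone.trans hterm

/-- Orthogonality of the characters attached to the linear forms on a finite vector space. -/
theorem sum_dual_stdAddChar {p : ℕ} [Fact p.Prime] {V : Type*} [AddCommGroup V]
    [Module (ZMod p) V] [Fintype V] [Fintype (Module.Dual (ZMod p) V)] (x : V) :
    ∑ ξ : Module.Dual (ZMod p) V, ZMod.stdAddChar (ξ x) =
      if x = 0 then (Fintype.card V : ℂ) else 0 := by
  split_ifs with hx
  · subst hx
    simp only [map_zero, AddChar.map_zero_eq_one, Finset.sum_const, nsmul_eq_mul, mul_one,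
      Finset.card_univ]
    rw [Module.card_eq_pow_finrank (K := ZMod p) (V := V),
      Module.card_eq_pow_finrank (K := ZMod p) (V := Module.Dual (ZMod p) V),
      Subspace.dual_finrank_eq]
  · let φ : AddChar (Module.Dual (ZMod p) V) ℂ :=
      { toFun := fun ξ => ZMod.stdAddChar (ξ x)
        map_zero_eq_one' := by simp
        map_add_eq_mul' := fun a b => by simp [AddChar.map_add_eq_mul] }
    refine AddChar.sum_eq_zero_of_ne_one (ψ := φ) fun h => hx ?_
    refine (Module.forall_dual_apply_eq_zero_iff (ZMod p) x).1 fun ξ => ?_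
    refine ZMod.injective_stdAddChar ?_
    have : φ ξ = 1 := by rw [h]; rfl
    rw [AddChar.map_zero_eq_one]
    exact this

/-- The energy of `Y` at the frequency `ξ`. -/
noncomputable def fourierEnergy {p : ℕ} [NeZero p] {V : Type*} [AddCommGroup V]
    [Module (ZMod p) V] (Y : Finset V) (ξ : Module.Dual (ZMod p) V) : ℝ :=
  ‖∑ y ∈ Y, ZMod.stdAddChar (ξ y)‖ ^ 2

theorem fourierEnergy_eq {p : ℕ} [NeZero p] {V : Type*} [AddCommGroup V]
    [Module (ZMod p) V] (Y : Finset V) (ξ : Module.Dual (ZMod p) V) :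
    (fourierEnergy Y ξ : ℂ) = ∑ y ∈ Y, ∑ z ∈ Y, ZMod.stdAddChar (ξ (y - z)) := by
  rw [fourierEnergy, Complex.ofReal_pow, ← Complex.mul_conj', map_sum, Finset.sum_mul_sum]
  refine Finset.sum_congr rfl fun y _ => Finset.sum_congr rfl fun z _ => ?_
  rw [← AddChar.map_neg_eq_conj, ← AddChar.map_add_eq_mul, map_sub, sub_eq_add_neg]

theorem sum_fourierEnergy_mul {p : ℕ} [Fact p.Prime] {V : Type*} [AddCommGroup V]
    [Module (ZMod p) V] [Fintype V] [Fintype (Module.Dual (ZMod p) V)] (Y : Finset V) (d : V) :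
    ∑ ξ : Module.Dual (ZMod p) V, fourierEnergy Y ξ * (ZMod.stdAddChar (ξ d)).re =
      Fintype.card V * (Y.filter fun y => y + d ∈ Y).card := by
  have key : ∑ ξ : Module.Dual (ZMod p) V, (fourierEnergy Y ξ : ℂ) * ZMod.stdAddChar (ξ d) =
      Fintype.card V * (Y.filter fun y => y + d ∈ Y).card := by
    simp_rw [fourierEnergy_eq, Finset.sum_mul, ← AddChar.map_add_eq_mul, ← map_add]
    rw [Finset.sum_comm]
    simp_rw [Finset.sum_comm (s := Finset.univ) (t := Y), sum_dual_stdAddChar]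
    rw [Finset.card_filter, Nat.cast_sum, Finset.mul_sum]
    refine Finset.sum_congr rfl fun y _ => ?_
    have : ∀ z, (y - z + d = 0) ↔ (y + d = z) := fun z => by
      rw [← sub_eq_zero (a := y + d), sub_add_eq_add_sub]
    simp_rw [this]
    rw [Finset.sum_ite_eq]
    split_ifs <;> simp
  have := congrArg Complex.re key
  simpa [Complex.re_sum, Complex.mul_re] using this

theorem sum_fourierEnergy_mul_one_sub {p : ℕ} [Fact p.Prime] {V : Type*} [AddCommGroup V]
    [Module (ZMod p) V] [Fintype V] [Fintype (Module.Dual (ZMod p) V)] (Y : Finset V) (d : V) :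
    ∑ ξ : Module.Dual (ZMod p) V, fourierEnergy Y ξ * (1 - (ZMod.stdAddChar (ξ d)).re) =
      Fintype.card V * escapeCard Y d := by
  have h0 := sum_fourierEnergy_mul (p := p) Y (0 : V)
  have h1 := sum_fourierEnergy_mul (p := p) Y d
  simp only [map_zero, AddChar.map_zero_eq_one, Complex.one_re, mul_one, add_zero,
    Finset.filter_true_of_mem (fun _ h => h)] at h0
  simp_rw [mul_sub, mul_one, Finset.sum_sub_distrib]
  rw [h0, h1, ← mul_sub, escapeCard,
    ← Finset.card_filter_add_card_filter_not (s := Y) (fun y => y + d ∈ Y)]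
  push_cast
  ring

end Expansion

section ShortZeroSums

theorem card_natAbs_valMinAbs_lt_le {p : ℕ} [NeZero p] (v : ℕ) :
    (Finset.univ.filter fun u : ZMod p => u.valMinAbs.natAbs < v).card ≤ 2 * v := by
  have h : (Finset.univ.filter fun u : ZMod p => u.valMinAbs.natAbs < v) ⊆
      (Finset.Ioo (-(v : ℤ)) v).image fun k : ℤ => (k : ZMod p) := by
    intro u hu
    rw [Finset.mem_filter] at hu
    refine Finset.mem_image.2 ⟨u.valMinAbs, ?_, ZMod.coe_valMinAbs u⟩
    rw [Finset.mem_Ioo]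
    omega
  refine (Finset.card_le_card h).trans (Finset.card_image_le.trans ?_)
  rw [Int.card_Ioo]
  omega

/-- If no value is too popular, then typical differences are large in absolute value. -/
theorem mul_card_le_sum_natAbs_valMinAbs {p : ℕ} [NeZero p] {ι : Type*} (s : Finset ι)
    (u : ι → ZMod p) (v : ℕ) (hconc : ∀ t, 4 * v * (s.filter fun i => u i = t).card ≤ s.card)
    (t : ZMod p) : v * s.card ≤ 2 * ∑ j ∈ s, (u j - t).valMinAbs.natAbs := by
  set B := s.filter fun j => (u j - t).valMinAbs.natAbs < v with hB
  have hBcard : 2 * B.card ≤ s.card := by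
    rcases Nat.eq_zero_or_pos v with h0 | hv
    · simp [hB, h0]
    have h1 : 4 * v * B.card ≤ 2 * v * s.card := by
      have hmaps : ∀ j ∈ B, u j - t ∈
          (Finset.univ.filter fun u : ZMod p => u.valMinAbs.natAbs < v) := fun j hj => by
        simpa using (Finset.mem_filter.1 hj).2
      rw [Finset.card_eq_sum_card_fiberwise hmaps, Finset.mul_sum]
      refine (Finset.sum_le_card_nsmul _ _ s.card fun x _ => ?_).trans ?_
      · refine le_trans (Nat.mul_le_mul_left _ (Finset.card_le_card ?_)) (hconc (x + t))
        intro j hj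
        simp only [hB, Finset.mem_filter] at hj ⊢
        exact ⟨hj.1.1, by rw [← hj.2]; abel⟩
      · rw [smul_eq_mul]
        exact Nat.mul_le_mul_right _ (card_natAbs_valMinAbs_lt_le v)
    have h2 : (2 * v) * (2 * B.card) ≤ (2 * v) * s.card := by linarith
    exact Nat.le_of_mul_le_mul_left h2 (by omega)
  have hsplit := Finset.card_filter_add_card_filter_not (s := s)
    (fun j => (u j - t).valMinAbs.natAbs < v)
  have hsum : (s.filter fun j => ¬ (u j - t).valMinAbs.natAbs < v).card * v ≤
      ∑ j ∈ s, (u j - t).valMinAbs.natAbs := by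
    rw [← smul_eq_mul]
    refine (Finset.card_nsmul_le_sum _ _ v fun j hj => ?_).trans
      (Finset.sum_le_sum_of_subset (Finset.filter_subset _ _))
    exact not_lt.1 (Finset.mem_filter.1 hj).2
  rw [← hB] at hsplit
  nlinarith

/-- A family that is not concentrated on an affine hyperplane contains a difference that expands
every set of at most half the size of the space. -/
theorem exists_mul_card_le_escapeCard {p : ℕ} [Fact p.Prime] {V : Type*} [AddCommGroup V]
    [Module (ZMod p) V] [Fintype V] {ι : Type*} (a : ι → V) (s : Finset ι) (hs : s.Nonempty)
    {v J : ℕ} (hJ : p ≤ 2 ^ J)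
    (hconc : ∀ ξ : Module.Dual (ZMod p) V, ξ ≠ 0 → ∀ t,
      4 * v * (s.filter fun i => ξ (a i) = t).card ≤ s.card)
    (Y : Finset V) (hY : 2 * Y.card ≤ Fintype.card V) :
    ∃ i ∈ s, ∃ j ∈ s, v * Y.card ≤ 2 * p * J * escapeCard Y (a j - a i) := by
  have : Finite (Module.Dual (ZMod p) V) := Module.finite_of_finite (ZMod p)
  let _ : Fintype (Module.Dual (ZMod p) V) := Fintype.ofFinite _
  have hp : (0 : ℝ) < p := by exact_mod_cast (Fact.out : p.Prime).pos
  have hm : 0 < s.card := hs.card_pos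
  have hV : 0 < Fintype.card V := Fintype.card_pos
  have hEnn : ∀ ξ : Module.Dual (ZMod p) V, 0 ≤ fourierEnergy Y ξ := fun ξ => by
    unfold fourierEnergy; positivity
  -- total energy away from the trivial frequency
  have hE : (Fintype.card V : ℝ) * Y.card ≤
      2 * ∑ ξ ∈ Finset.univ.erase (0 : Module.Dual (ZMod p) V), fourierEnergy Y ξ := by
    have h0 := sum_fourierEnergy_mul (p := p) Y (0 : V)
    simp only [map_zero, AddChar.map_zero_eq_one, Complex.one_re, mul_one, add_zero,
      Finset.filter_true_of_mem (fun _ h => h)] at h0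
    rw [← Finset.add_sum_erase _ _ (Finset.mem_univ (0 : Module.Dual (ZMod p) V))] at h0
    have hz : fourierEnergy Y (0 : Module.Dual (ZMod p) V) = (Y.card : ℝ) ^ 2 := by
      simp [fourierEnergy]
    have hY' : (2 : ℝ) * Y.card ≤ Fintype.card V := by exact_mod_cast hY
    rw [hz] at h0
    nlinarith [(Nat.cast_nonneg Y.card : (0 : ℝ) ≤ Y.card)]
  -- escape counts dominate the frequency side
  have hd : ∀ d : V, 2 * ∑ ξ : Module.Dual (ZMod p) V,
      fourierEnergy Y ξ * ((ξ d).valMinAbs.natAbs : ℝ) ≤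
        p * (J * (Fintype.card V * escapeCard Y d)) := by
    intro d
    calc 2 * ∑ ξ : Module.Dual (ZMod p) V, fourierEnergy Y ξ * ((ξ d).valMinAbs.natAbs : ℝ)
        = ∑ ξ : Module.Dual (ZMod p) V,
            fourierEnergy Y ξ * (2 * ((ξ d).valMinAbs.natAbs : ℝ)) := by
          rw [Finset.mul_sum]
          exact Finset.sum_congr rfl fun _ _ => by ring
      _ ≤ ∑ ξ : Module.Dual (ZMod p) V, fourierEnergy Y ξ * (p * ∑ j ∈ Finset.range J,
            (1 - (ZMod.stdAddChar ((2 ^ j : ℕ) • ξ d)).re) / 2 ^ j) :=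
          Finset.sum_le_sum fun ξ _ => mul_le_mul_of_nonneg_left
            (natAbs_valMinAbs_le_sum_dyadic hJ _) (hEnn ξ)
      _ = p * ∑ j ∈ Finset.range J,
            ((Fintype.card V : ℝ) * escapeCard Y ((2 ^ j : ℕ) • d)) / 2 ^ j := by
          simp_rw [← sum_fourierEnergy_mul_one_sub (p := p), Finset.sum_div, Finset.mul_sum]
          rw [Finset.sum_comm]
          refine Finset.sum_congr rfl fun j _ => Finset.sum_congr rfl fun ξ _ => ?_
          rw [map_nsmul ξ]
          ring
      _ ≤ p * ∑ j ∈ Finset.range J, (Fintype.card V * escapeCard Y d : ℝ) := by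
          gcongr with j _
          rw [div_le_iff₀ (by positivity), mul_assoc]
          gcongr
          rw [mul_comm]
          exact_mod_cast escapeCard_two_pow_nsmul_le Y d j
      _ = _ := by simp
  by_contra! hcon
  have hlt : ∑ i ∈ s, ∑ j ∈ s, (2 * (p * (J * (Fintype.card V * escapeCard Y (a j - a i)))) : ℝ) <
      ∑ i ∈ s, ∑ j ∈ s, (Fintype.card V * (v * Y.card) : ℝ) := by
    refine Finset.sum_lt_sum_of_nonempty hs fun i hi => Finset.sum_lt_sum_of_nonempty hs
      fun j hj => ?_
    have h : ((2 * p * J * escapeCard Y (a j - a i) : ℕ) : ℝ) < (v * Y.card : ℕ) := by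
      exact_mod_cast hcon i hi j hj
    push_cast at h
    have hV' : (0 : ℝ) < Fintype.card V := by exact_mod_cast hV
    nlinarith
  refine absurd hlt (not_lt.2 ?_)
  have hfreq : ∀ ξ ∈ Finset.univ.erase (0 : Module.Dual (ZMod p) V),
      (s.card : ℝ) * (v * s.card) ≤
        2 * ∑ i ∈ s, ∑ j ∈ s, ((ξ (a j - a i)).valMinAbs.natAbs : ℝ) := by
    intro ξ hξ
    rw [Finset.mul_sum, ← nsmul_eq_mul]
    refine Finset.card_nsmul_le_sum _ _ _ fun i _ => ?_
    have := mul_card_le_sum_natAbs_valMinAbs s (fun j => ξ (a j)) v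
      (hconc ξ (Finset.ne_of_mem_erase hξ)) (ξ (a i))
    simp_rw [map_sub]
    exact_mod_cast this
  calc ∑ i ∈ s, ∑ j ∈ s, (Fintype.card V * (v * Y.card) : ℝ)
      = (Fintype.card V * Y.card) * (s.card * (v * s.card)) := by
        simp only [Finset.sum_const, nsmul_eq_mul]
        ring
    _ ≤ (2 * ∑ ξ ∈ Finset.univ.erase (0 : Module.Dual (ZMod p) V), fourierEnergy Y ξ) *
          (s.card * (v * s.card)) := by gcongr
    _ = 2 * ∑ ξ ∈ Finset.univ.erase (0 : Module.Dual (ZMod p) V),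
          fourierEnergy Y ξ * (s.card * (v * s.card)) := by
        rw [mul_assoc, Finset.sum_mul]
    _ ≤ 2 * ∑ ξ ∈ Finset.univ.erase (0 : Module.Dual (ZMod p) V),
          fourierEnergy Y ξ *
            (2 * ∑ i ∈ s, ∑ j ∈ s, ((ξ (a j - a i)).valMinAbs.natAbs : ℝ)) := by
        refine mul_le_mul_of_nonneg_left (Finset.sum_le_sum fun ξ hξ => ?_) zero_le_two
        exact mul_le_mul_of_nonneg_left (hfreq ξ hξ) (hEnn ξ)
    _ ≤ 2 * ∑ ξ : Module.Dual (ZMod p) V,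
          fourierEnergy Y ξ *
            (2 * ∑ i ∈ s, ∑ j ∈ s, ((ξ (a j - a i)).valMinAbs.natAbs : ℝ)) := by
        gcongr ?_ * ?_
        refine Finset.sum_le_sum_of_subset_of_nonneg (Finset.erase_subset _ _) fun ξ _ _ =>
          mul_nonneg (hEnn ξ) (by positivity)
    _ = ∑ i ∈ s, ∑ j ∈ s, 2 * (2 * ∑ ξ : Module.Dual (ZMod p) V,
          fourierEnergy Y ξ * ((ξ (a j - a i)).valMinAbs.natAbs : ℝ)) := by
        simp_rw [Finset.mul_sum]
        rw [Finset.sum_comm]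
        refine Finset.sum_congr rfl fun i _ => ?_
        rw [Finset.sum_comm]
        refine Finset.sum_congr rfl fun j _ => Finset.sum_congr rfl fun ξ _ => ?_
        ring
    _ ≤ _ := by
        refine Finset.sum_le_sum fun i _ => Finset.sum_le_sum fun j _ => ?_
        exact mul_le_mul_of_nonneg_left (hd _) zero_le_two

theorem card_add_escapeCard_le {V : Type*} [AddCommGroup V] (Y : Finset V) (b c : V) :
    Y.card + escapeCard Y (c - b) ≤ ((Y.image fun y => y + b) ∪ Y.image fun y => y + c).card := by
  have hdisj : Disjoint (Y.image fun y => y + b)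
      ((Y.filter fun y => y + (c - b) ∉ Y).image fun y => y + c) := by
    rw [Finset.disjoint_left]
    intro x hx hx'
    obtain ⟨y, hy, rfl⟩ := Finset.mem_image.1 hx
    obtain ⟨z, hz, hzy⟩ := Finset.mem_image.1 hx'
    refine (Finset.mem_filter.1 hz).2 ?_
    have : z + (c - b) = y := by
      rw [← add_sub_assoc, hzy, add_sub_cancel_right]
    rwa [this]
  rw [escapeCard, ← Finset.card_image_of_injective Y (add_left_injective b),
    ← Finset.card_image_of_injective (Y.filter fun y => y + (c - b) ∉ Y) (add_left_injective c)]
  rw [← Finset.card_union_of_disjoint hdisj]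
  exact Finset.card_le_card (Finset.union_subset_union_right
    (Finset.image_subset_image (Finset.filter_subset _ _)))

/-- Iterating the expansion step: from a well-spread family one extracts `2 n` members whose
`n`-term subset sums are numerous. -/
theorem exists_many_subset_sums {p : ℕ} [Fact p.Prime] {V : Type*} [AddCommGroup V]
    [Module (ZMod p) V] [Fintype V] {ι : Type*} (a : ι → V) (s₀ : Finset ι)
    {v J : ℕ} (hv : 0 < v) (hJ : p ≤ 2 ^ J)
    (hconc : ∀ ξ : Module.Dual (ZMod p) V, ξ ≠ 0 → ∀ t,
      8 * v * (s₀.filter fun i => ξ (a i) = t).card ≤ s₀.card)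
    (s : Finset ι) (hs : s ⊆ s₀) (n : ℕ) (hn : s₀.card + 4 * n ≤ 2 * s.card) :
    ∃ U ⊆ s, U.card = 2 * n ∧ ∃ Y : Finset V,
      (∀ y ∈ Y, ∃ t ⊆ U, t.card = n ∧ ∑ i ∈ t, a i = y) ∧
      (Fintype.card V < 2 * Y.card ∨ (1 + (v : ℝ) / (2 * p * J)) ^ n ≤ Y.card) := by
  have hp := (Fact.out : p.Prime).two_le
  have hJ0 : 0 < J := by
    rcases Nat.eq_zero_or_pos J with rfl | h
    · simp at hJ
      omega
    · exact h
  have hβ : (0 : ℝ) < 1 + (v : ℝ) / (2 * p * J) := by positivity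
  induction n with
  | zero =>
    refine ⟨∅, Finset.empty_subset _, rfl, {0}, fun y hy => ⟨∅, subset_rfl, rfl, ?_⟩, Or.inr ?_⟩
    · simpa using (Finset.mem_singleton.1 hy).symm
    · simp
  | succ n ih =>
    obtain ⟨U, hUs, hUcard, Y, hY, hlarge⟩ := ih (by omega)
    have hcard : (s \ U).card = s.card - 2 * n := by
      rw [Finset.card_sdiff_of_subset hUs, hUcard]
    have hYpos : 0 < Y.card := by
      rcases hlarge with h | h
      · omega
      · have : (0 : ℝ) < Y.card := lt_of_lt_of_le (by positivity) h
        exact_mod_cast this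
    -- two fresh indices together with the growth they produce
    obtain ⟨i, hi, j, hj, hij, hgrow⟩ : ∃ i ∈ s \ U, ∃ j ∈ s \ U, i ≠ j ∧
        (Fintype.card V < 2 * Y.card ∨ v * Y.card ≤ 2 * p * J * escapeCard Y (a j - a i)) := by
      by_cases hbig : Fintype.card V < 2 * Y.card
      · have hsc : s.card ≤ s₀.card := Finset.card_le_card hs
        obtain ⟨i, hi, j, hj, hij⟩ := Finset.one_lt_card.1 (show 1 < (s \ U).card by omega)
        exact ⟨i, hi, j, hj, hij, Or.inl hbig⟩
      · have hsc : s.card ≤ s₀.card := Finset.card_le_card hs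
        have hne : (s \ U).Nonempty := Finset.card_pos.1 (by omega)
        obtain ⟨i, hi, j, hj, h⟩ := exists_mul_card_le_escapeCard a (s \ U) hne hJ
          (v := v) (fun ξ hξ t => by
            have h1 := hconc ξ hξ t
            have h2 : ((s \ U).filter fun i => ξ (a i) = t).card ≤
                (s₀.filter fun i => ξ (a i) = t).card :=
              Finset.card_le_card
                (Finset.filter_subset_filter _ (Finset.sdiff_subset.trans hs))
            have h3 := Nat.mul_le_mul_left (8 * v) h2
            have h4 : s₀.card ≤ 2 * (s \ U).card := by omega
            nlinarith) Y (by omega)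
        refine ⟨i, hi, j, hj, ?_, Or.inr h⟩
        rintro rfl
        have h0 : escapeCard Y (0 : V) = 0 := by simp [escapeCard]
        rw [sub_self, h0, mul_zero] at h
        have := Nat.mul_pos hv hYpos
        omega
    rw [Finset.mem_sdiff] at hi hj
    have hUij : (insert i (insert j U)).card = 2 * (n + 1) := by
      rw [Finset.card_insert_of_notMem, Finset.card_insert_of_notMem hj.2, hUcard]
      · ring
      · simp [hij, hi.2]
    have hkey := card_add_escapeCard_le Y (a i) (a j)
    refine ⟨insert i (insert j U), ?_, hUij,
      (Y.image fun y => y + a i) ∪ Y.image fun y => y + a j, ?_, ?_⟩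
    · exact Finset.insert_subset hi.1 (Finset.insert_subset hj.1 hUs)
    · intro y hy
      rw [Finset.mem_union, Finset.mem_image, Finset.mem_image] at hy
      rcases hy with ⟨z, hz, rfl⟩ | ⟨z, hz, rfl⟩ <;> obtain ⟨t, htU, htc, rfl⟩ := hY z hz
      · refine ⟨insert i t, ?_, ?_, ?_⟩
        · exact Finset.insert_subset_insert _ (htU.trans (Finset.subset_insert _ _))
        · rw [Finset.card_insert_of_notMem (fun h => hi.2 (htU h)), htc]
        · rw [Finset.sum_insert (fun h => hi.2 (htU h)), add_comm]
      · refine ⟨insert j t, ?_, ?_, ?_⟩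
        · exact (Finset.insert_subset_insert _ htU).trans (Finset.subset_insert _ _)
        · rw [Finset.card_insert_of_notMem (fun h => hj.2 (htU h)), htc]
        · rw [Finset.sum_insert (fun h => hj.2 (htU h)), add_comm]
    · rcases hgrow with h | h
      · left
        omega
      rcases hlarge with hl | hl
      · left
        omega
      right
      have hkey' : (Y.card : ℝ) + escapeCard Y (a j - a i) ≤
          ((Y.image fun y => y + a i) ∪ Y.image fun y => y + a j).card := by
        exact_mod_cast hkey
      have h' : (v : ℝ) * Y.card ≤ 2 * p * J * escapeCard Y (a j - a i) := by exact_mod_cast h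
      have hden : (0 : ℝ) < 2 * p * J := by positivity
      have h'' : (v : ℝ) / (2 * p * J) * Y.card ≤ escapeCard Y (a j - a i) := by
        rw [div_mul_eq_mul_div, div_le_iff₀ hden]
        linarith
      rw [pow_succ]
      nlinarith

/-- A well-spread family in a finite vector space over `ZMod p` has a zero-sum of length `p`. -/
theorem exists_zero_sum_of_spread {p n : ℕ} [Fact p.Prime] (hpn : p = 2 * n + 1) {V : Type*}
    [AddCommGroup V] [Module (ZMod p) V] [Fintype V] {ι : Type*} (a : ι → V) (s : Finset ι)
    {v J : ℕ} (hv : 0 < v) (hJ : p ≤ 2 ^ J)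
    (hgrow : (Fintype.card V : ℝ) ≤ (1 + (v : ℝ) / (2 * p * J)) ^ n)
    (hconc : ∀ ξ : Module.Dual (ZMod p) V, ξ ≠ 0 → ∀ t,
      8 * v * (s.filter fun i => ξ (a i) = t).card ≤ s.card)
    (hs : 8 * p ≤ s.card) :
    ∃ t ⊆ s, t.card = p ∧ ∑ i ∈ t, a i = 0 := by
  have hV : 0 < Fintype.card V := Fintype.card_pos
  have hhalf : ∀ Y : Finset V, (Fintype.card V < 2 * Y.card ∨
      (1 + (v : ℝ) / (2 * p * J)) ^ n ≤ Y.card) → Fintype.card V < 2 * Y.card := by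
    rintro Y (h | h)
    · exact h
    · have : Fintype.card V ≤ Y.card := by exact_mod_cast hgrow.trans h
      omega
  obtain ⟨U, hUs, hUc, Y, hY, hYl⟩ :=
    exists_many_subset_sums a s hv hJ hconc s subset_rfl n (by omega)
  have hc1 : (s \ U).card = s.card - 2 * n := by
    rw [Finset.card_sdiff_of_subset hUs, hUc]
  obtain ⟨U', hUs', hUc', Y', hY', hYl'⟩ :=
    exists_many_subset_sums a s hv hJ hconc (s \ U) Finset.sdiff_subset n (by omega)
  have hc2 : ((s \ U) \ U').card = s.card - 2 * n - 2 * n := by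
    rw [Finset.card_sdiff_of_subset hUs', hUc', hc1]
  obtain ⟨x, hx⟩ := Finset.card_pos.1 (show 0 < ((s \ U) \ U').card by omega)
  rw [Finset.mem_sdiff, Finset.mem_sdiff] at hx
  -- pigeonhole: `Y` meets the reflection of `Y'`
  obtain ⟨y, hy, hy'⟩ : ∃ y ∈ Y, -a x - y ∈ Y' := by
    by_contra! hcon
    have hdisj : Disjoint (Y.image fun y => -a x - y) Y' := by
      rw [Finset.disjoint_left]
      intro z hz hz'
      obtain ⟨y, hy, rfl⟩ := Finset.mem_image.1 hz
      exact hcon y hy hz'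
    have h1 := Finset.card_union_of_disjoint hdisj
    rw [Finset.card_image_of_injective _ (sub_right_injective)] at h1
    have h2 := Finset.card_le_univ ((Y.image fun y => -a x - y) ∪ Y')
    have := hhalf Y hYl
    have := hhalf Y' hYl'
    omega
  obtain ⟨t, ht, htc, hts⟩ := hY y hy
  obtain ⟨t', ht', htc', hts'⟩ := hY' _ hy'
  have hd : Disjoint t t' := by
    rw [Finset.disjoint_left]
    exact fun i hi hi' => (Finset.mem_sdiff.1 (hUs' (ht' hi'))).2 (ht hi)
  have hxt : x ∉ t ∪ t' := by
    rw [Finset.mem_union]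
    rintro (h | h)
    · exact hx.1.2 (ht h)
    · exact hx.2 (ht' h)
  refine ⟨insert x (t ∪ t'), ?_, ?_, ?_⟩
  · exact Finset.insert_subset hx.1.1 (Finset.union_subset (ht.trans hUs)
      ((ht'.trans hUs').trans Finset.sdiff_subset))
  · rw [Finset.card_insert_of_notMem hxt, Finset.card_union_of_disjoint hd, htc, htc']
    omega
  · rw [Finset.sum_insert hxt, Finset.sum_union hd, hts, hts']
    abel

/-- Zero-sums of length `p` in long families over a vector space of bounded dimension. -/
theorem exists_zero_sum_card_eq_prime {p n : ℕ} [Fact p.Prime] (hpn : p = 2 * n + 1) {R v J : ℕ}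
    (hv : 0 < v) (hJ : p ≤ 2 ^ J) (hgrow : (p : ℝ) ^ R ≤ (1 + (v : ℝ) / (2 * p * J)) ^ n)
    {ι : Type*} (k : ℕ) (hk : k ≤ R) {V : Type*} [AddCommGroup V] [Module (ZMod p) V] [Finite V]
    (hV : Module.finrank (ZMod p) V ≤ k) (a : ι → V) (s : Finset ι)
    (hs : 8 * p * (8 * v) ^ k ≤ s.card) :
    ∃ t ⊆ s, t.card = p ∧ ∑ i ∈ t, a i = 0 := by
  induction k generalizing V s with
  | zero =>
    have : Subsingleton V := Module.finrank_zero_iff.1 (Nat.le_zero.1 hV)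
    obtain ⟨t, ht, htc⟩ := Finset.exists_subset_card_eq (show p ≤ s.card by
      rw [pow_zero] at hs
      omega)
    exact ⟨t, ht, htc, Subsingleton.elim _ _⟩
  | succ k ih =>
    let _ : Fintype V := Fintype.ofFinite V
    have hp := (Fact.out : p.Prime).pos
    by_cases hconc : ∀ ξ : Module.Dual (ZMod p) V, ξ ≠ 0 → ∀ t,
      8 * v * (s.filter fun i => ξ (a i) = t).card ≤ s.card
    · refine exists_zero_sum_of_spread hpn a s hv hJ (le_trans ?_ hgrow) hconc
        (le_trans (Nat.le_mul_of_pos_right _ (by positivity)) hs)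
      rw [Module.card_eq_pow_finrank (K := ZMod p) (V := V), ZMod.card]
      push_cast
      exact pow_le_pow_right₀ (by exact_mod_cast hp) (hV.trans hk)
    · push Not at hconc
      obtain ⟨ξ, hξ, c, hc⟩ := hconc
      set F := s.filter fun i => ξ (a i) = c with hF
      have hFcard : 8 * p * (8 * v) ^ k ≤ F.card := by
        rw [pow_succ] at hs
        by_contra! hlt
        have : 8 * v * (F.card + 1) ≤ 8 * v * (8 * p * (8 * v) ^ k) :=
          Nat.mul_le_mul_left _ hlt
        nlinarith
      obtain ⟨i₀, hi₀⟩ := Finset.card_pos.1 (lt_of_lt_of_le (by positivity) hFcard)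
      have hker : ∀ i ∈ F, a i - a i₀ ∈ LinearMap.ker ξ := by
        intro i hi
        rw [LinearMap.mem_ker, map_sub, (Finset.mem_filter.1 hi).2, (Finset.mem_filter.1 hi₀).2,
          sub_self]
      have hrank : Module.finrank (ZMod p) (LinearMap.ker ξ) ≤ k := by
        have h1 : Module.finrank (ZMod p) (LinearMap.ker ξ) < Module.finrank (ZMod p) V := by
          refine Submodule.finrank_lt fun h => hξ ?_
          exact LinearMap.ker_eq_top.1 h
        omega
      obtain ⟨t, ht, htc, hts⟩ := ih (by omega) hrank
        (fun i => if h : a i - a i₀ ∈ LinearMap.ker ξ then ⟨a i - a i₀, h⟩ else 0) F hFcard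
      refine ⟨t, ht.trans (Finset.filter_subset _ _), htc, ?_⟩
      have h1 := congrArg (LinearMap.ker ξ).subtype hts
      rw [map_sum, map_zero] at h1
      have h2 : ∑ i ∈ t, (a i - a i₀) = 0 := by
        rw [← h1]
        refine Finset.sum_congr rfl fun i hi => ?_
        rw [dif_pos (hker i (ht hi))]
        rfl
      rw [Finset.sum_sub_distrib, Finset.sum_const, htc, ← Nat.cast_smul_eq_nsmul (ZMod p),
        CharP.cast_eq_zero, zero_smul, sub_zero] at h2
      exact h2

theorem exists_forall_mul_pow_le_mul_two_pow (C c : ℝ) (hc : 0 < c) (m : ℕ) :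
    ∃ J₀ : ℕ, ∀ J ≥ J₀, C * (J : ℝ) ^ m ≤ c * 2 ^ J := by
  have h : Filter.Tendsto (fun J : ℕ => C * ((J : ℝ) ^ m / 2 ^ J)) Filter.atTop (nhds (C * 0)) :=
    (tendsto_pow_const_div_const_pow_of_one_lt m one_lt_two).const_mul C
  rw [mul_zero] at h
  obtain ⟨J₀, hJ₀⟩ := Filter.eventually_atTop.1 (h.eventually (gt_mem_nhds hc))
  refine ⟨J₀, fun J hJ => ?_⟩
  have := hJ₀ J hJ
  rw [← mul_div_assoc, div_lt_iff₀ (by positivity)] at this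
  exact this.le

theorem pow_le_one_add_div_pow {p n R J : ℕ} (hp : 0 < p) (hJ0 : 0 < J) (hpn : p = 2 * n + 1)
    (hJ : p ≤ 2 ^ J) (hsmall : 8 * R * J + 4 ≤ 3 * p) :
    (p : ℝ) ^ R ≤ (1 + ((16 * (R + 1) * J ^ 2 : ℕ) : ℝ) / (2 * p * J)) ^ n := by
  have hpR : (0 : ℝ) < p := by exact_mod_cast hp
  have hJR : (0 : ℝ) < J := by exact_mod_cast hJ0
  have hβ : ((16 * (R + 1) * J ^ 2 : ℕ) : ℝ) / (2 * p * J) = 8 * (R + 1) * J / p := by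
    push_cast
    field_simp
    ring
  rw [hβ]
  set β : ℝ := 8 * (R + 1) * J / p with hβdef
  have hβpos : 0 < β := by positivity
  set q := 8 * (R + 1) * J with hq
  have hqpos : 0 < q := by positivity
  set K := p / q + 1 with hK
  have hK1 : 1 ≤ (K : ℝ) * β := by
    rw [hβdef, ← mul_div_assoc, one_le_div hpR]
    have : p ≤ K * q := by
      have := Nat.lt_div_mul_add (a := p) hqpos
      rw [hK, add_mul, one_mul]
      exact this.le
    have h2 : (p : ℝ) ≤ K * (8 * (R + 1) * J) := by exact_mod_cast this
    exact h2
  have hKn : K * (R * J) ≤ n := by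
    have h1 : p / q * q ≤ p := Nat.div_mul_le_self p q
    have h2 : p / q * (8 * R * J) ≤ p / q * q := by
      rw [hq]
      gcongr
      omega
    have h3 : 8 * (K * (R * J)) = p / q * (8 * R * J) + 8 * R * J := by
      rw [hK]
      ring
    omega
  have hbern : (2 : ℝ) ≤ (1 + β) ^ K := by
    have := one_add_mul_le_pow (show (-2 : ℝ) ≤ β by linarith) K
    linarith
  calc (p : ℝ) ^ R ≤ (2 ^ J) ^ R := by
        gcongr
        exact_mod_cast hJ
    _ = 2 ^ (R * J) := by rw [← pow_mul, mul_comm]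
    _ ≤ ((1 + β) ^ K) ^ (R * J) := by gcongr
    _ = (1 + β) ^ (K * (R * J)) := by rw [← pow_mul]
    _ ≤ (1 + β) ^ n := pow_le_pow_right₀ (by linarith) hKn

universe u w

/-- For a large prime `p`, any `δ p ^ 2` vectors in a space of dimension at most `R` over `ZMod p`
contain `p` with sum zero. -/
theorem exists_forall_exists_zero_sum_card_eq (R : ℕ) (δ : ℝ) (hδ : 0 < δ) :
    ∃ N : ℕ, ∀ p : ℕ, N ≤ p → ∀ _ : Fact p.Prime, ∀ (V : Type u) [AddCommGroup V]
      [Module (ZMod p) V] [Finite V], Module.finrank (ZMod p) V ≤ R →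
      ∀ {ι : Type w} (a : ι → V) (s : Finset ι), δ * (p : ℝ) ^ 2 ≤ s.card →
        ∃ t ⊆ s, t.card = p ∧ ∑ i ∈ t, a i = 0 := by
  obtain ⟨J₁, hJ₁⟩ := exists_forall_mul_pow_le_mul_two_pow (8 * R + 4) (3 / 2) (by norm_num) 1
  obtain ⟨J₂, hJ₂⟩ := exists_forall_mul_pow_le_mul_two_pow (8 * (128 * (R + 1)) ^ R) (δ / 2)
    (by positivity) (2 * R)
  refine ⟨2 ^ (J₁ + J₂ + 2), fun p hNp hprime V _ _ _ hV ι a s hs => ?_⟩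
  have hp : p.Prime := hprime.out
  set J := Nat.log 2 p + 1 with hJ
  have hpJ : p ≤ 2 ^ J := (Nat.lt_pow_succ_log_self (by norm_num) p).le
  have hJp : 2 ^ J ≤ 2 * p := by
    rw [hJ, pow_succ]
    have := Nat.pow_log_le_self 2 hp.ne_zero
    omega
  have hlog : J₁ + J₂ + 2 ≤ Nat.log 2 p := Nat.le_log_of_pow_le (by norm_num) hNp
  have hJpR : (2 : ℝ) ^ J ≤ 2 * p := by exact_mod_cast hJp
  have hJ1 : (1 : ℝ) ≤ J := by
    rw [hJ]
    push_cast
    linarith [(Nat.cast_nonneg (Nat.log 2 p) : (0 : ℝ) ≤ _)]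
  have h1 := hJ₁ J (by omega)
  have h2 := hJ₂ J (by omega)
  have hsmall : 8 * R * J + 4 ≤ 3 * p := by
    have : (8 * R * J + 4 : ℝ) ≤ 3 * p := by
      rw [pow_one] at h1
      nlinarith
    exact_mod_cast this
  have hp2 : 2 < p := by
    have : 2 ^ 2 ≤ p := (Nat.pow_le_pow_right (by norm_num) (by omega)).trans hNp
    omega
  obtain ⟨n, hn⟩ := hp.odd_of_ne_two hp2.ne'
  refine exists_zero_sum_card_eq_prime (R := R) (v := 16 * (R + 1) * J ^ 2) (J := J) hn
    (by positivity) hpJ (pow_le_one_add_div_pow hp.pos (by omega) hn hpJ hsmall) R le_rfl hV a s ?_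
  have hfin : (8 * p * (8 * (16 * (R + 1) * J ^ 2)) ^ R : ℝ) ≤ s.card := by
    refine le_trans ?_ hs
    have hpow : (8 * (16 * (R + 1) * (J : ℝ) ^ 2)) ^ R = (128 * (R + 1)) ^ R * (J : ℝ) ^ (2 * R) := by
      rw [pow_mul, ← mul_pow]
      ring
    rw [hpow]
    have : 8 * (128 * (R + 1 : ℝ)) ^ R * (J : ℝ) ^ (2 * R) ≤ δ * p := by nlinarith
    nlinarith [(Nat.cast_nonneg p : (0 : ℝ) ≤ p)]
  exact_mod_cast hfin

end ShortZeroSums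

section Davenport

/-- The Davenport constant of an elementary abelian `p`-group, via Chevalley-Warning. -/
theorem exists_zero_sum_of_finrank_mul_lt {p : ℕ} [Fact p.Prime] {V : Type*} [AddCommGroup V]
    [Module (ZMod p) V] [Finite V] {ι : Type*} (a : ι → V) (s : Finset ι)
    (hs : Module.finrank (ZMod p) V * (p - 1) < s.card) :
    ∃ t ⊆ s, t.Nonempty ∧ ∑ i ∈ t, a i = 0 := by
  have hp : p.Prime := Fact.out
  let b := Module.finBasis (ZMod p) V
  let f : Fin (Module.finrank (ZMod p) V) → MvPolynomial s (ZMod p) := fun j =>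
    ∑ i : s, MvPolynomial.C (b.repr (a i) j) * MvPolynomial.X i ^ (p - 1)
  have hdeg : ∀ j, (f j).totalDegree ≤ p - 1 := fun j =>
    MvPolynomial.totalDegree_finsetSum_le fun i _ => by
      refine (MvPolynomial.totalDegree_mul _ _).trans ?_
      rw [MvPolynomial.totalDegree_C, zero_add, MvPolynomial.totalDegree_X_pow]
  have hdvd := char_dvd_card_solutions_of_sum_lt (K := ZMod p) p (s := Finset.univ) (f := f) (by
    refine (Finset.sum_le_card_nsmul _ _ (p - 1) fun j _ => hdeg j).trans_lt ?_
    rwa [Finset.card_univ, Fintype.card_fin, smul_eq_mul, Fintype.card_coe])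
  have hzero : ∀ j ∈ Finset.univ, MvPolynomial.eval (0 : s → ZMod p) (f j) = 0 := by
    intro j _
    simp [f, zero_pow (Nat.sub_ne_zero_of_lt hp.one_lt)]
  have hcard : 1 < Fintype.card
      {x : s → ZMod p // ∀ j ∈ Finset.univ, MvPolynomial.eval x (f j) = 0} :=
    lt_of_lt_of_le hp.one_lt (Nat.le_of_dvd (Fintype.card_pos_iff.2 ⟨⟨0, hzero⟩⟩)
      (by convert hdvd))
  obtain ⟨⟨x, hx⟩, hne⟩ := Fintype.exists_ne_of_one_lt_card hcard ⟨0, hzero⟩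
  have hx0 : x ≠ 0 := fun h => hne (Subtype.ext h)
  obtain ⟨i₀, hi₀⟩ := Function.ne_iff.1 hx0
  refine ⟨(Finset.univ.filter fun i : s => x i ≠ 0).map (Function.Embedding.subtype _), ?_, ?_, ?_⟩
  · intro i hi
    obtain ⟨i', _, rfl⟩ := Finset.mem_map.1 hi
    exact i'.2
  · exact (Finset.map_nonempty).2 ⟨i₀, Finset.mem_filter.2 ⟨Finset.mem_univ _, hi₀⟩⟩
  · rw [Finset.sum_map]
    refine b.repr.injective (Finsupp.ext fun j => ?_)
    have h := hx j (Finset.mem_univ j)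
    simp only [f, map_sum, map_mul, MvPolynomial.eval_C, map_pow, MvPolynomial.eval_X] at h
    rw [map_sum, Finsupp.finsetSum_apply, map_zero, Finsupp.zero_apply, Finset.sum_filter]
    refine Eq.trans (Finset.sum_congr rfl fun i _ => ?_) h
    split_ifs with hxi
    · rw [ZMod.pow_card_sub_one_eq_one hxi, mul_one]
      rfl
    · rw [not_not.1 hxi, zero_pow (Nat.sub_ne_zero_of_lt hp.one_lt), mul_zero]

end Davenport

section Torsion

theorem exists_submodule_data_of_card_torsion_le {p k : ℕ} [Fact p.Prime] {G : Type*}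
    [AddCommGroup G] [Finite G] (hG : Nat.card {x : G // p • x = 0} ≤ p ^ k)
    [Module (ZMod p) (nsmulAddMonoidHom p : G →+ G).ker] :
    Module.finrank (ZMod p) (nsmulAddMonoidHom p : G →+ G).ker ≤ k := by
  have hp : p.Prime := Fact.out
  have h : Nat.card (nsmulAddMonoidHom p : G →+ G).ker =
      p ^ Module.finrank (ZMod p) (nsmulAddMonoidHom p : G →+ G).ker := by
    let _ : Fintype (nsmulAddMonoidHom p : G →+ G).ker := Fintype.ofFinite _
    rw [Nat.card_eq_fintype_card, Module.card_eq_pow_finrank (K := ZMod p), ZMod.card]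
  have h2 : Nat.card (nsmulAddMonoidHom p : G →+ G).ker = Nat.card {x : G // p • x = 0} :=
    Nat.card_congr (Equiv.subtypeEquivRight fun x => AddMonoidHom.mem_ker)
  rw [← h2, h] at hG
  exact (Nat.pow_le_pow_iff_right hp.one_lt).1 hG

theorem sum_torsion_lift {p : ℕ} {G : Type*} [AddCommGroup G] {ι : Type*} {a : ι → G}
    {s t : Finset ι} (ha : ∀ i ∈ s, p • a i = 0) (ht : t ⊆ s)
    (h : ∑ i ∈ t, (if h : a i ∈ (nsmulAddMonoidHom p : G →+ G).ker then
      (⟨a i, h⟩ : (nsmulAddMonoidHom p : G →+ G).ker) else 0) = 0) : ∑ i ∈ t, a i = 0 := by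
  have h1 := congrArg (nsmulAddMonoidHom p : G →+ G).ker.subtype h
  rw [map_sum, map_zero] at h1
  rw [← h1]
  refine Finset.sum_congr rfl fun i hi => ?_
  have hi' : a i ∈ (nsmulAddMonoidHom p : G →+ G).ker := AddMonoidHom.mem_ker.2 (ha i (ht hi))
  rw [dif_pos hi']
  rfl

theorem ker_nsmul_char {p : ℕ} {G : Type*} [AddCommGroup G]
    (x : (nsmulAddMonoidHom p : G →+ G).ker) : p • x = 0 :=
  Subtype.ext (AddMonoidHom.mem_ker.1 x.2)

universe u w

/-- Group version of the short zero-sum theorem, for families of `p`-torsion elements. -/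
theorem exists_forall_torsion_zero_sum_card_eq (R : ℕ) (δ : ℝ) (hδ : 0 < δ) :
    ∃ N : ℕ, ∀ p : ℕ, N ≤ p → p.Prime → ∀ (G : Type u) [AddCommGroup G] [Finite G],
      Nat.card {x : G // p • x = 0} ≤ p ^ R →
      ∀ {ι : Type w} (a : ι → G) (s : Finset ι), (∀ i ∈ s, p • a i = 0) →
        δ * (p : ℝ) ^ 2 ≤ s.card → ∃ t ⊆ s, t.card = p ∧ ∑ i ∈ t, a i = 0 := by
  obtain ⟨N, hN⟩ := exists_forall_exists_zero_sum_card_eq.{u, w} R δ hδ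
  refine ⟨N, fun p hNp hp G _ _ hG ι a s ha hs => ?_⟩
  have hfact : Fact p.Prime := ⟨hp⟩
  let _ : Module (ZMod p) (nsmulAddMonoidHom p : G →+ G).ker :=
    AddCommGroup.zmodModule ker_nsmul_char
  obtain ⟨t, ht, htc, hts⟩ := hN p hNp hfact (nsmulAddMonoidHom p : G →+ G).ker
    (exists_submodule_data_of_card_torsion_le hG)
    (fun i => if h : a i ∈ (nsmulAddMonoidHom p : G →+ G).ker then ⟨a i, h⟩ else 0) s hs
  exact ⟨t, ht, htc, sum_torsion_lift ha ht hts⟩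

theorem exists_torsion_zero_sum {p k : ℕ} (hp : p.Prime) {G : Type*} [AddCommGroup G] [Finite G]
    (hG : Nat.card {x : G // p • x = 0} ≤ p ^ k) {ι : Type*} (a : ι → G) (s : Finset ι)
    (ha : ∀ i ∈ s, p • a i = 0) (hs : k * (p - 1) < s.card) :
    ∃ t ⊆ s, t.Nonempty ∧ ∑ i ∈ t, a i = 0 := by
  have hfact : Fact p.Prime := ⟨hp⟩
  let _ : Module (ZMod p) (nsmulAddMonoidHom p : G →+ G).ker :=
    AddCommGroup.zmodModule ker_nsmul_char
  obtain ⟨t, ht, htc, hts⟩ := exists_zero_sum_of_finrank_mul_lt (p := p)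
    (fun i => if h : a i ∈ (nsmulAddMonoidHom p : G →+ G).ker then
      (⟨a i, h⟩ : (nsmulAddMonoidHom p : G →+ G).ker) else 0) s
    (lt_of_le_of_lt (Nat.mul_le_mul_right _ (exists_submodule_data_of_card_torsion_le hG)) hs)
  exact ⟨t, ht, htc, sum_torsion_lift ha ht hts⟩

end Torsion

section Reduction

theorem Multiset.exists_eq_map_univ_fin {α : Type*} (S : Multiset α) :
    ∃ (m : ℕ) (f : Fin m → α), S = Finset.univ.val.map f := by
  induction S using Quotient.inductionOn with
  | h L => exact ⟨L.length, L.get, by rw [Fin.univ_val_map, List.ofFn_get]; rfl⟩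

theorem IsZeroSumFree.cons_sum_sub {G : Type*} [AddCommGroup G] {S T : Multiset G}
    (hS : IsZeroSumFree S) (hT : T ≤ S) (hT0 : T ≠ 0) :
    IsZeroSumFree (T.sum ::ₘ (S - T)) := by
  intro U hU hU0
  by_cases hmem : T.sum ∈ U
  · obtain ⟨W, rfl⟩ := Multiset.exists_cons_of_mem hmem
    have hW : W ≤ S - T := (Multiset.cons_le_cons_iff _).1 hU
    rw [Multiset.sum_cons, ← Multiset.sum_add]
    refine hS (T + W) ?_ fun h => hT0 (Multiset.le_zero.1 (h ▸ Multiset.le_add_right T W))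
    rw [← Multiset.sub_add_cancel hT, add_comm T]
    exact Multiset.add_le_add_right hW
  · exact hS U (((Multiset.le_cons_of_notMem hmem).1 hU).trans (Multiset.sub_le_self _ _)) hU0

theorem crossNumber_add {G : Type*} [AddCommGroup G] (S T : Multiset G) :
    crossNumber (S + T) = crossNumber S + crossNumber T := by
  simp [crossNumber]

theorem crossNumber_map_univ {G : Type*} [AddCommGroup G] {ι : Type*} (s : Finset ι) (f : ι → G) :
    crossNumber (s.val.map f) = ∑ i ∈ s, (1 : ℝ) / addOrderOf (f i) := by
  rw [crossNumber, Multiset.map_map]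
  rfl

/-- Bound for the cross number of a zero-sumfree sequence, obtained by replacing short
subsequences of elements of a common composite order by their sums. -/
theorem crossNumber_le_of_isZeroSumFree {G : Type*} [AddCommGroup G] [Finite G] {n : ℕ}
    (hn : n ≠ 0) (hkill : ∀ x : G, n • x = 0) (δ : ℝ) (ρ : ℕ → ℕ)
    (hshort : ∀ p ∈ n.primeFactors, ∀ {m : ℕ} (a : Fin m → G) (s : Finset (Fin m)),
      (∀ i ∈ s, p • a i = 0) → δ * (p : ℝ) ^ 2 ≤ s.card → ∃ t ⊆ s, t.card = p ∧ ∑ i ∈ t, a i = 0)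
    (hdav : ∀ p ∈ n.primeFactors, ∀ {m : ℕ} (a : Fin m → G) (s : Finset (Fin m)),
      (∀ i ∈ s, p • a i = 0) → ρ p * (p - 1) < s.card →
        ∃ t ⊆ s, t.Nonempty ∧ ∑ i ∈ t, a i = 0)
    (S : Multiset G) (hS : IsZeroSumFree S) :
    crossNumber S ≤ ∑ p ∈ n.primeFactors, (ρ p : ℝ) +
      ∑ d ∈ n.divisors.filter (fun d => d ≠ 1 ∧ ¬ d.Prime), δ * (d.minFac : ℝ) ^ 2 / d := by
  induction hc : Multiset.card S using Nat.strong_induction_on generalizing S with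
  | _ c ih =>
  subst hc
  obtain ⟨m, f, rfl⟩ := S.exists_eq_map_univ_fin
  have hle : ∀ t : Finset (Fin m), t.val.map f ≤ Finset.univ.val.map f := fun t =>
    Multiset.map_le_map (Finset.val_le_iff.2 (Finset.subset_univ t))
  have hfree : ∀ t : Finset (Fin m), t.Nonempty → ∑ i ∈ t, f i ≠ 0 := fun t ht =>
    hS _ (hle t) fun h => ht.ne_empty (Finset.val_eq_zero.1 (Multiset.map_eq_zero.1 h))
  have hord : ∀ i, addOrderOf (f i) ∈ n.divisors := fun i =>
    Nat.mem_divisors.2 ⟨addOrderOf_dvd_of_nsmul_eq_zero (hkill _), hn⟩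
  set s : ℕ → Finset (Fin m) := fun d => Finset.univ.filter fun i => addOrderOf (f i) = d with hs
  have hs_mem : ∀ {d i}, i ∈ s d ↔ addOrderOf (f i) = d := by simp [hs]
  by_cases hex : ∃ d ∈ n.divisors, d ≠ 1 ∧ ¬ d.Prime ∧ δ * (d.minFac : ℝ) ^ 2 ≤ (s d).card
  · obtain ⟨d, hd, hd1, hdp, hds⟩ := hex
    rw [Nat.mem_divisors] at hd
    have hpp : d.minFac.Prime := Nat.minFac_prime hd1
    obtain ⟨e, he⟩ := Nat.minFac_dvd d
    set p := d.minFac with hp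
    have hd0 : 0 < d := Nat.pos_of_dvd_of_pos hd.1 (Nat.pos_of_ne_zero hn)
    have he0 : 0 < e := Nat.pos_of_ne_zero fun h => by simp [h] at he; omega
    obtain ⟨t, hts, htc, ht0⟩ := hshort p
      (Nat.mem_primeFactors.2 ⟨hpp, (Nat.minFac_dvd d).trans hd.1, hn⟩) (fun i => e • f i) (s d)
      (fun i hi => by
        rw [← mul_nsmul', ← he, ← hs_mem.1 hi]
        exact addOrderOf_nsmul_eq_zero _) hds
    rw [← Finset.smul_sum] at ht0
    set T := t.val.map f with hT
    have hTcard : Multiset.card T = p := by rw [hT, Multiset.card_map]; exact htc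
    have hT0 : T ≠ 0 := by
      rw [← Multiset.card_pos, hTcard]
      exact hpp.pos
    have hsum : T.sum = ∑ i ∈ t, f i := rfl
    have hcT : crossNumber T = (p : ℝ) / d := by
      rw [hT, crossNumber_map_univ, Finset.sum_congr rfl fun i hi => by
        rw [hs_mem.1 (hts hi)], Finset.sum_const, htc, nsmul_eq_mul, mul_one_div]
    have hσ : (p : ℝ) / d ≤ 1 / addOrderOf T.sum := by
      have h1 : addOrderOf T.sum ≤ e := Nat.le_of_dvd he0 (addOrderOf_dvd_of_nsmul_eq_zero ht0)
      have h2 : 0 < addOrderOf T.sum := addOrderOf_pos _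
      have h3 : p * addOrderOf T.sum ≤ d := by
        calc p * addOrderOf T.sum ≤ p * e := Nat.mul_le_mul_left _ h1
          _ = d := he.symm
      rw [div_le_div_iff₀ (by exact_mod_cast hd0) (by exact_mod_cast h2), one_mul]
      exact_mod_cast h3
    have hstep := ih (Multiset.card (T.sum ::ₘ (Finset.univ.val.map f - T))) (by
      rw [Multiset.card_cons, Multiset.card_sub (hle t), hTcard]
      have hcard : Multiset.card T ≤ Multiset.card (Finset.univ.val.map f) :=
        Multiset.card_le_card (hle t)
      rw [hTcard] at hcard
      have := hpp.two_le
      omega) _ (hS.cons_sum_sub (hle t) hT0) rfl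
    refine le_trans ?_ hstep
    have h1 : crossNumber (Finset.univ.val.map f) =
        crossNumber (Finset.univ.val.map f - T) + crossNumber T := by
      rw [← crossNumber_add, Multiset.sub_add_cancel (hle t)]
    have h2 : crossNumber (T.sum ::ₘ (Finset.univ.val.map f - T)) =
        1 / addOrderOf T.sum + crossNumber (Finset.univ.val.map f - T) := by
      simp [crossNumber]
    rw [h1, h2, hcT]
    linarith
  · push Not at hex
    rw [crossNumber_map_univ, ← Finset.sum_fiberwise_of_maps_to (fun i _ => hord i)]
    have hprimes : n.primeFactors = n.divisors.filter Nat.Prime := by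
      ext q
      simp only [Nat.mem_primeFactors, Finset.mem_filter, Nat.mem_divisors]
      tauto
    rw [hprimes, Finset.sum_filter, Finset.sum_filter, ← Finset.sum_add_distrib]
    refine Finset.sum_le_sum fun d hd => ?_
    have hval : ∑ i ∈ Finset.univ with addOrderOf (f i) = d, (1 : ℝ) / addOrderOf (f i) =
        (s d).card / d := by
      rw [Finset.sum_congr rfl fun i hi => by rw [(Finset.mem_filter.1 hi).2], Finset.sum_const,
        nsmul_eq_mul, mul_one_div]
    rw [hval]
    have hd0 : 0 < d := Nat.pos_of_mem_divisors hd
    have hd0' : (0 : ℝ) < d := by exact_mod_cast hd0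
    by_cases hd1 : d = 1
    · have hempty : s d = ∅ := by
        rw [Finset.eq_empty_iff_forall_notMem]
        intro i hi
        refine hfree {i} (Finset.singleton_nonempty i) ?_
        rw [Finset.sum_singleton]
        exact AddMonoid.addOrderOf_eq_one_iff.1 ((hs_mem.1 hi).trans hd1)
      rw [hempty]
      simp [hd1, Nat.not_prime_one]
    by_cases hdp : d.Prime
    · rw [if_pos hdp, if_neg (fun h => h.2 hdp), add_zero, div_le_iff₀ hd0']
      have hbound : (s d).card ≤ ρ d * (d - 1) := by
        by_contra! hlt
        obtain ⟨t, _, htne, ht0⟩ := hdav d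
          (Nat.mem_primeFactors.2 ⟨hdp, Nat.dvd_of_mem_divisors hd, hn⟩) f (s d) (fun i hi => by
            rw [← hs_mem.1 hi]
            exact addOrderOf_nsmul_eq_zero _) hlt
        exact hfree t htne ht0
      have : (s d).card ≤ ρ d * d := hbound.trans (Nat.mul_le_mul_left _ (Nat.sub_le _ _))
      exact_mod_cast this
    · rw [if_neg hdp, if_pos ⟨hd1, hdp⟩, zero_add]
      have := hex d hd hd1 hdp
      gcongr

end Reduction

section DivisorSum

theorem sum_divisors_inv_le (n : ℕ) (hn : n ≠ 0) :
    ∑ d ∈ n.divisors, (1 : ℝ) / d ≤ 2 ^ n.primeFactors.card := by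
  induction n using Nat.recOnPosPrimePosCoprime with
  | prime_pow p k hp hk =>
    rw [Nat.sum_divisors_prime_pow hp, Nat.primeFactors_prime_pow hk.ne' hp,
      Finset.card_singleton, pow_one]
    have hp2 : (1 : ℝ) / p ≤ 1 / 2 := by
      have : (2 : ℝ) ≤ p := by exact_mod_cast hp.two_le
      gcongr
    calc ∑ i ∈ Finset.range (k + 1), (1 : ℝ) / ((p ^ i : ℕ) : ℝ)
        ≤ ∑ i ∈ Finset.range (k + 1), (1 / 2 : ℝ) ^ i := by
          refine Finset.sum_le_sum fun i _ => ?_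
          rw [Nat.cast_pow, ← one_div_pow]
          exact pow_le_pow_left₀ (by positivity) hp2 i
      _ ≤ 2 := sum_geometric_two_le _
  | zero => exact absurd rfl hn
  | one => simp
  | coprime a b ha hb hab iha ihb =>
    have h : ∑ d ∈ (a * b).divisors, (1 : ℝ) / d =
        (∑ d ∈ a.divisors, (1 : ℝ) / d) * ∑ d ∈ b.divisors, (1 : ℝ) / d := by
      rw [Nat.divisors_mul, Finset.mul_def, Finset.sum_image hab.mul_injOn_divisors,
        Finset.sum_mul_sum, Finset.sum_product]
      refine Finset.sum_congr rfl fun x _ => Finset.sum_congr rfl fun y _ => ?_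
      rw [Nat.cast_mul, div_mul_div_comm, one_mul]
    rw [h, hab.primeFactors_mul, Finset.card_union_of_disjoint hab.disjoint_primeFactors, pow_add]
    exact mul_le_mul (iha (by omega)) (ihb (by omega)) (by positivity) (by positivity)

/-- Sum of `P⁻(d)² / d` over the composite divisors `d` of `n`. -/
theorem sum_minFac_sq_div_le (n : ℕ) (hn : n ≠ 0) :
    ∑ d ∈ n.divisors.filter (fun d => d ≠ 1 ∧ ¬ d.Prime), (d.minFac : ℝ) ^ 2 / d ≤
      (n.primeFactors.card : ℝ) ^ 2 * 2 ^ n.primeFactors.card := by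
  set φ : ℕ → ℕ × ℕ × ℕ := fun d =>
    (d.minFac, (d / d.minFac).minFac, d / d.minFac / (d / d.minFac).minFac) with hφ
  have key : ∀ d ∈ n.divisors.filter (fun d => d ≠ 1 ∧ ¬ d.Prime),
      d = (φ d).1 * ((φ d).2.1 * (φ d).2.2) ∧ (φ d).1.Prime ∧ (φ d).2.1.Prime ∧
        (φ d).1 ≤ (φ d).2.1 ∧ d ∣ n := by
    intro d hd
    obtain ⟨hdn, hd1, hdp⟩ := Finset.mem_filter.1 hd
    have hd0 : 0 < d := Nat.pos_of_mem_divisors hdn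
    have hp := Nat.minFac_prime hd1
    have h1 : d.minFac * (d / d.minFac) = d := Nat.mul_div_cancel' (Nat.minFac_dvd d)
    have hne : d / d.minFac ≠ 1 := fun h => hdp (by rw [h, mul_one] at h1; rwa [← h1])
    have hq := Nat.minFac_prime hne
    have h2 : (d / d.minFac).minFac * (d / d.minFac / (d / d.minFac).minFac) = d / d.minFac :=
      Nat.mul_div_cancel' (Nat.minFac_dvd _)
    refine ⟨by simp only [hφ]; rw [h2, h1], hp, hq, ?_, Nat.dvd_of_mem_divisors hdn⟩
    exact Nat.minFac_le_of_dvd hq.two_le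
      ((Nat.minFac_dvd _).trans (Nat.div_dvd_of_dvd (Nat.minFac_dvd d)))
  have hinj : Set.InjOn φ (n.divisors.filter (fun d => d ≠ 1 ∧ ¬ d.Prime)) := by
    intro x hx y hy hxy
    rw [(key x hx).1, (key y hy).1, hxy]
  have hle : ∀ d ∈ n.divisors.filter (fun d => d ≠ 1 ∧ ¬ d.Prime),
      (d.minFac : ℝ) ^ 2 / d ≤ 1 / ((φ d).2.2 : ℝ) := by
    intro d hd
    obtain ⟨h1, hp, hq, hpq, hdn⟩ := key d hd
    have hd0 : 0 < d := Nat.pos_of_dvd_of_pos hdn (Nat.pos_of_ne_zero hn)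
    have hm : 0 < (φ d).2.2 := Nat.pos_of_ne_zero fun h => by simp [h] at h1; omega
    have hmp : d.minFac = (φ d).1 := rfl
    rw [div_le_div_iff₀ (by exact_mod_cast hd0) (by exact_mod_cast hm), one_mul, hmp]
    have : (φ d).1 ^ 2 * (φ d).2.2 ≤ d := by
      calc (φ d).1 ^ 2 * (φ d).2.2 = (φ d).1 * ((φ d).1 * (φ d).2.2) := by ring
        _ ≤ (φ d).1 * ((φ d).2.1 * (φ d).2.2) := by gcongr
        _ = d := h1.symm
    exact_mod_cast this
  calc _ ≤ ∑ d ∈ n.divisors.filter (fun d => d ≠ 1 ∧ ¬ d.Prime), 1 / ((φ d).2.2 : ℝ) :=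
        Finset.sum_le_sum hle
    _ = ∑ x ∈ (n.divisors.filter (fun d => d ≠ 1 ∧ ¬ d.Prime)).image φ, 1 / (x.2.2 : ℝ) :=
        (Finset.sum_image (f := fun x : ℕ × ℕ × ℕ => 1 / (x.2.2 : ℝ)) hinj).symm
    _ ≤ ∑ x ∈ n.primeFactors ×ˢ (n.primeFactors ×ˢ n.divisors), 1 / (x.2.2 : ℝ) := by
        refine Finset.sum_le_sum_of_subset_of_nonneg ?_ fun _ _ _ => by positivity
        intro x hx
        obtain ⟨d, hd, rfl⟩ := Finset.mem_image.1 hx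
        obtain ⟨h1, hp, hq, hpq, hdn⟩ := key d hd
        simp only [Finset.mem_product, Nat.mem_primeFactors, Nat.mem_divisors]
        refine ⟨⟨hp, dvd_trans ⟨_, h1⟩ hdn, hn⟩, ⟨hq, dvd_trans ⟨(φ d).1 * (φ d).2.2, ?_⟩ hdn, hn⟩,
          dvd_trans ⟨(φ d).1 * (φ d).2.1, ?_⟩ hdn, hn⟩
        · rw [mul_left_comm]; exact h1
        · rw [mul_comm, mul_assoc]; exact h1
    _ = (n.primeFactors.card : ℝ) ^ 2 * ∑ d ∈ n.divisors, (1 : ℝ) / d := by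
        simp only [Finset.sum_product, Finset.sum_const, nsmul_eq_mul]
        ring
    _ ≤ _ := by
        gcongr
        exact sum_divisors_inv_le n hn

end DivisorSum

section LowerBound

theorem Multiset.exists_eq_sum_replicate_of_le {ι α : Type*} (A : Finset ι) (e : ι → α)
    (c : ι → ℕ) (T : Multiset α) (hT : T ≤ ∑ x ∈ A, Multiset.replicate (c x) (e x)) :
    ∃ d : ι → ℕ, (∀ x ∈ A, d x ≤ c x) ∧ T = ∑ x ∈ A, Multiset.replicate (d x) (e x) := by
  induction A using Finset.induction_on generalizing T with
  | empty => exact ⟨fun _ => 0, by simp, by simpa using hT⟩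
  | insert a A ha ih =>
    rw [Finset.sum_insert ha] at hT
    obtain ⟨d, hd, hdT⟩ := ih (T - Multiset.replicate (c a) (e a)) (tsub_le_iff_left.2 hT)
    obtain ⟨k, hk, hkT⟩ := Multiset.le_replicate_iff.1
      (Multiset.inter_le_right (s := T) (t := Multiset.replicate (c a) (e a)))
    refine ⟨Function.update d a k, fun x hx => ?_, ?_⟩
    · obtain rfl | hx := Finset.mem_insert.1 hx
      · simpa using hk
      · rw [Function.update_of_ne (ne_of_mem_of_not_mem hx ha)]
        exact hd x hx
    · rw [Finset.sum_insert ha, Function.update_self, ← hkT]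
      rw [Finset.sum_congr rfl fun x hx => by
        rw [Function.update_of_ne (ne_of_mem_of_not_mem hx ha)], ← hdT, add_comm]
      exact (Multiset.sub_add_inter _ _).symm

theorem eq_zero_of_dvd_sum_mul_div {n : ℕ} (d : ℕ → ℕ)
    (hd : ∀ p ∈ n.primeFactors, d p < p) (h : n ∣ ∑ p ∈ n.primeFactors, d p * (n / p)) :
    ∀ p ∈ n.primeFactors, d p = 0 := by
  intro q hq
  have hqp := Nat.prime_of_mem_primeFactors hq
  set m := ∏ p ∈ n.primeFactors.erase q, p with hm
  have h1 : n ∣ ∑ p ∈ n.primeFactors, m * (d p * (n / p)) := by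
    rw [← Finset.mul_sum]
    exact h.mul_left m
  rw [← Finset.add_sum_erase _ _ hq] at h1
  have h2 : n ∣ ∑ p ∈ n.primeFactors.erase q, m * (d p * (n / p)) := by
    refine Finset.dvd_sum fun p hp => ?_
    obtain ⟨k, hk⟩ : p ∣ m := Finset.dvd_prod_of_mem (fun p => p) hp
    refine ⟨k * d p, ?_⟩
    have := Nat.mul_div_cancel' (Nat.dvd_of_mem_primeFactors (Finset.mem_of_mem_erase hp))
    calc m * (d p * (n / p)) = p * (n / p) * (k * d p) := by rw [hk]; ring
      _ = n * (k * d p) := by rw [this]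
  have h3 : n ∣ m * (d q * (n / q)) := (Nat.dvd_add_left h2).1 h1
  have h4 : n / q * q ∣ n / q * (m * d q) := by
    rw [Nat.div_mul_cancel (Nat.dvd_of_mem_primeFactors hq)]
    convert h3 using 1
    ring
  have h5 : q ∣ m * d q := Nat.dvd_of_mul_dvd_mul_left
    (Nat.div_pos (Nat.le_of_mem_primeFactors hq) hqp.pos) h4
  rcases hqp.dvd_mul.1 h5 with h6 | h6
  · obtain ⟨p, hp, hqp'⟩ := (hqp.prime.dvd_finsetProd_iff _).1 h6
    have := (Nat.prime_dvd_prime_iff_eq hqp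
      (Nat.prime_of_mem_primeFactors (Finset.mem_of_mem_erase hp))).1 hqp'
    exact absurd this.symm (Finset.ne_of_mem_erase hp)
  · exact Nat.eq_zero_of_dvd_of_lt h6 (hd q hq)

theorem addOrderOf_pi_single_div {r : ℕ} (n : Fin r → ℕ) (hn : ∀ i, n i ≠ 0) (i : Fin r) {p : ℕ}
    (hp : p ∈ (n i).primeFactors) :
    addOrderOf (Pi.single i ((n i / p : ℕ) : ZMod (n i)) : ∀ i, ZMod (n i)) = p := by
  have h := addOrderOf_injective (AddMonoidHom.single (fun i => ZMod (n i)) i)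
    (Pi.single_injective (M := fun i => ZMod (n i)) i) ((n i / p : ℕ) : ZMod (n i))
  rw [AddMonoidHom.single_apply] at h
  rw [h, ZMod.addOrderOf_coe _ (hn i),
    Nat.gcd_eq_right (Nat.div_dvd_of_dvd (Nat.dvd_of_mem_primeFactors hp)),
    Nat.div_div_self (Nat.dvd_of_mem_primeFactors hp) (hn i)]

/-- A zero-sumfree sequence consisting of elements of prime order. -/
theorem exists_isZeroSumFree_crossNumber_eq {r : ℕ} (n : Fin r → ℕ) (hn : ∀ i, n i ≠ 0) :
    ∃ S : Multiset (∀ i, ZMod (n i)), IsZeroSumFree S ∧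
      crossNumber S = ∑ i, ∑ p ∈ (n i).primeFactors, (1 - 1 / (p : ℝ)) := by
  set A : Finset (Σ _ : Fin r, ℕ) := Finset.univ.sigma fun i => (n i).primeFactors with hA
  set e : (Σ _ : Fin r, ℕ) → ∀ i, ZMod (n i) :=
    fun x => Pi.single x.1 ((n x.1 / x.2 : ℕ) : ZMod (n x.1)) with he
  refine ⟨∑ x ∈ A, Multiset.replicate (x.2 - 1) (e x), ?_, ?_⟩
  · intro T hT hT0 hsum
    obtain ⟨d, hd, rfl⟩ := Multiset.exists_eq_sum_replicate_of_le A e (fun x => x.2 - 1) T hT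
    refine hT0 (Finset.sum_eq_zero ?_)
    rintro ⟨i, p⟩ hx
    have hsum' : ∑ x ∈ A, d x • e x = 0 := by
      rw [← hsum, ← Multiset.coe_sumAddMonoidHom, map_sum]
      exact Finset.sum_congr rfl fun x _ => by simp
    have hi := congrFun hsum' i
    rw [hA, Finset.sum_sigma, Finset.sum_apply, Finset.sum_eq_single i
      (fun j _ hj => by
        rw [Finset.sum_apply]
        exact Finset.sum_eq_zero fun q _ => by simp [he, hj.symm]) (by simp),
      Finset.sum_apply, Pi.zero_apply] at hi
    have hdvd : n i ∣ ∑ q ∈ (n i).primeFactors, d ⟨i, q⟩ * (n i / q) := by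
      rw [← ZMod.natCast_eq_zero_iff, ← hi]
      push_cast
      exact Finset.sum_congr rfl fun q _ => by simp [he]
    have := eq_zero_of_dvd_sum_mul_div (fun q => d ⟨i, q⟩) (fun q hq => by
      have h1 := hd ⟨i, q⟩ (by simpa [hA] using hq)
      have h2 := (Nat.prime_of_mem_primeFactors hq).pos
      simp only at h1
      omega) hdvd p (by simpa [hA] using hx)
    rw [show d ⟨i, p⟩ = 0 from this, Multiset.replicate_zero]
  · have hsum : ∀ B : Finset (Σ _ : Fin r, ℕ),
        crossNumber (∑ x ∈ B, Multiset.replicate (x.2 - 1) (e x)) =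
          ∑ x ∈ B, crossNumber (Multiset.replicate (x.2 - 1) (e x)) := by
      intro B
      induction B using Finset.induction_on with
      | empty => simp [crossNumber]
      | insert a B ha ih => rw [Finset.sum_insert ha, Finset.sum_insert ha, crossNumber_add, ih]
    rw [hsum, hA, Finset.sum_sigma]
    refine Finset.sum_congr rfl fun i _ => Finset.sum_congr rfl fun p hp => ?_
    have hp0 := (Nat.prime_of_mem_primeFactors hp).pos
    have hp0' : (p : ℝ) ≠ 0 := by exact_mod_cast hp0.ne'
    have hord : addOrderOf (e ⟨i, p⟩) = p := addOrderOf_pi_single_div n hn i hp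
    simp only [crossNumber, Multiset.map_replicate, Multiset.sum_replicate, hord, nsmul_eq_mul]
    rw [Nat.cast_sub hp0]
    field_simp
    simp

end LowerBound

section Counting

theorem ZMod.card_prime_torsion_le {n p : ℕ} (hn : n ≠ 0) (hp : p.Prime) :
    Nat.card {x : ZMod n // p • x = 0} ≤ if p ∣ n then p else 1 := by
  have : NeZero n := ⟨hn⟩
  split_ifs with h
  · rw [Nat.card_eq_fintype_card, Fintype.card_subtype]
    convert IsAddCyclic.card_nsmul_eq_zero_le (α := ZMod n) hp.pos
  · have hsub : Subsingleton {x : ZMod n // p • x = 0} := by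
      refine ⟨fun ⟨x, hx⟩ ⟨y, hy⟩ => Subtype.ext ?_⟩
      have hz : ∀ z : ZMod n, p • z = 0 → z = 0 := fun z hz => by
        have h1 := addOrderOf_dvd_of_nsmul_eq_zero hz
        have h2 : addOrderOf z ∣ n := addOrderOf_dvd_of_nsmul_eq_zero (by simp)
        have h3 := Nat.dvd_gcd h1 h2
        rw [(hp.coprime_iff_not_dvd.2 h : Nat.gcd p n = 1), Nat.dvd_one] at h3
        exact AddMonoid.addOrderOf_eq_one_iff.1 h3
      exact (hz x hx).trans (hz y hy).symm
    exact Finite.card_le_one_iff_subsingleton.2 hsub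

theorem card_pi_zmod_prime_torsion_le {r p : ℕ} (n : Fin r → ℕ) (hn : ∀ i, n i ≠ 0)
    (hp : p.Prime) :
    Nat.card {x : ∀ i, ZMod (n i) // p • x = 0} ≤
      p ^ (Finset.univ.filter fun i => p ∣ n i).card := by
  have h : Nat.card {x : ∀ i, ZMod (n i) // p • x = 0} =
      ∏ i, Nat.card {x : ZMod (n i) // p • x = 0} := by
    rw [← Nat.card_pi]
    exact Nat.card_congr ((Equiv.subtypeEquivRight fun x => by simp [funext_iff]).trans
      (Equiv.subtypePiEquivPi (p := fun i (y : ZMod (n i)) => p • y = 0)))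
  rw [h]
  refine (Finset.prod_le_prod' fun i _ => ZMod.card_prime_torsion_le (hn i) hp).trans_eq ?_
  rw [Finset.prod_ite, Finset.prod_const, Finset.prod_const_one, mul_one]

theorem sum_card_filter_dvd_eq {r N : ℕ} (n : Fin r → ℕ) (hN : N ≠ 0) (h : ∀ i, n i ∣ N) :
    ∑ p ∈ N.primeFactors, (Finset.univ.filter fun i => p ∣ n i).card =
      ∑ i, (n i).primeFactors.card := by
  simp only [Finset.card_filter]
  rw [Finset.sum_comm]
  refine Finset.sum_congr rfl fun i _ => ?_
  rw [← Finset.card_filter]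
  congr 1
  ext p
  simp only [Finset.mem_filter, Nat.mem_primeFactors]
  have hi : n i ≠ 0 := ne_zero_of_dvd_ne_zero hN (h i)
  exact ⟨fun hp => ⟨hp.1.1, hp.2, hi⟩, fun hp => ⟨⟨hp.1, hp.2.1.trans (h i), hN⟩, hp.2.1⟩⟩

end Counting

section LittleCrossNumber

/-- Upper bound for the cross number of zero-sumfree sequences over a sum of cyclic groups whose
orders divide `N`, when all prime divisors of `N` are large. -/
theorem exists_forall_crossNumber_le (r k : ℕ) (ε : ℝ) (hε : 0 < ε) :
    ∃ M : ℕ, ∀ (n : Fin r → ℕ) (N : ℕ), N ≠ 0 → (∀ i, n i ∣ N) → N.primeFactors.card = k →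
      (∀ p ∈ N.primeFactors, M ≤ p) → ∀ S : Multiset (∀ i, ZMod (n i)), IsZeroSumFree S →
        crossNumber S ≤ ∑ i, ((n i).primeFactors.card : ℝ) + ε := by
  set δ : ℝ := ε / ((k : ℝ) ^ 2 * 2 ^ k + 1) with hδ
  have hden : (0 : ℝ) < (k : ℝ) ^ 2 * 2 ^ k + 1 := by positivity
  have hδ0 : 0 < δ := div_pos hε hden
  obtain ⟨M, hM⟩ := exists_forall_torsion_zero_sum_card_eq.{0, 0} r δ hδ0
  refine ⟨M, fun n N hN hnN hk hp S hS => ?_⟩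
  have hn : ∀ i, n i ≠ 0 := fun i => ne_zero_of_dvd_ne_zero hN (hnN i)
  have : ∀ i, NeZero (n i) := fun i => ⟨hn i⟩
  have hkill : ∀ x : ∀ i, ZMod (n i), N • x = 0 := fun x => by
    ext i
    simp [(ZMod.natCast_eq_zero_iff N (n i)).2 (hnN i)]
  have hmain := crossNumber_le_of_isZeroSumFree hN hkill δ
    (fun p => (Finset.univ.filter fun i => p ∣ n i).card)
    (fun p hpN m a s ha hs => by
      have hpp := Nat.prime_of_mem_primeFactors hpN
      refine hM p (hp p hpN) hpp _ ?_ a s ha hs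
      refine (card_pi_zmod_prime_torsion_le n hn hpp).trans (Nat.pow_le_pow_right hpp.pos ?_)
      exact (Finset.card_le_univ _).trans_eq (Fintype.card_fin r))
    (fun p hpN m a s ha hs => by
      have hpp := Nat.prime_of_mem_primeFactors hpN
      exact exists_torsion_zero_sum hpp (card_pi_zmod_prime_torsion_le n hn hpp) a s ha hs) S hS
  have hsum : ∑ p ∈ N.primeFactors, ((Finset.univ.filter fun i => p ∣ n i).card : ℝ) =
      ∑ i, ((n i).primeFactors.card : ℝ) := by
    exact_mod_cast sum_card_filter_dvd_eq n hN hnN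
  have herr : ∑ d ∈ N.divisors.filter (fun d => d ≠ 1 ∧ ¬ d.Prime),
      δ * (d.minFac : ℝ) ^ 2 / d ≤ ε := by
    simp only [mul_div_assoc]
    rw [← Finset.mul_sum]
    have h1 := sum_minFac_sq_div_le N hN
    rw [hk] at h1
    calc _ ≤ δ * ((k : ℝ) ^ 2 * 2 ^ k + 1) := by
          refine mul_le_mul_of_nonneg_left (h1.trans ?_) hδ0.le
          linarith
      _ = ε := div_mul_cancel₀ _ hden.ne'
  rw [hsum] at hmain
  linarith

end LittleCrossNumber

theorem stmt14 (r : ℕ) (hr : 1 ≤ r) (l : Fin r → ℕ) (hl : ∀ i, 1 ≤ l i) :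
    ∀ ε : ℝ, 0 < ε → ∃ N : ℕ, ∀ n : Fin r → ℕ,
      (∀ i, 1 < n i) → (∀ i j : Fin r, i ≤ j → n i ∣ n j) →
      (∀ i, (n i).primeFactors.card = l i) →
      (∀ i, Nat.gcd (n i) (n ⟨r - 1, by omega⟩ / n i) = 1) →
      N ≤ (n ⟨r - 1, by omega⟩).minFac →
      |littleCrossNumber (∀ i : Fin r, ZMod (n i)) - ∑ i, (l i : ℝ)| < ε := by
  intro ε hε
  obtain ⟨M, hM⟩ := exists_forall_crossNumber_le r (l ⟨r - 1, by omega⟩) (ε / 2) (by linarith)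
  obtain ⟨K, hK⟩ := exists_nat_gt ((∑ i, (l i : ℝ)) / ε)
  refine ⟨max M K, fun n hn hdvd hl' _ hmin => ?_⟩
  set N := n ⟨r - 1, by omega⟩ with hN
  have hn0 : ∀ i, n i ≠ 0 := fun i => by have := hn i; omega
  have hnN : ∀ i, n i ∣ N := fun i => hdvd i _ (Fin.le_def.2 (by have := i.2; simp only; omega))
  have hbig : ∀ p ∈ N.primeFactors, max M K ≤ p := fun p hp =>
    hmin.trans (Nat.minFac_le_of_dvd (Nat.prime_of_mem_primeFactors hp).two_le
      (Nat.dvd_of_mem_primeFactors hp))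
  have hupper : ∀ S : Multiset (∀ i, ZMod (n i)), IsZeroSumFree S →
      crossNumber S ≤ ∑ i, (l i : ℝ) + ε / 2 := fun S hS => by
    have h := hM n N (hn0 _) hnN (hl' _) (fun p hp => (le_max_left _ _).trans (hbig p hp)) S hS
    simpa only [hl'] using h
  obtain ⟨S, hS, hSc⟩ := exists_isZeroSumFree_crossNumber_eq n hn0
  have hle : littleCrossNumber (∀ i : Fin r, ZMod (n i)) ≤ ∑ i, (l i : ℝ) + ε / 2 := by
    refine csSup_le ⟨_, S, hS, rfl⟩ ?_
    rintro x ⟨T, hT, rfl⟩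
    exact hupper T hT
  have hge : crossNumber S ≤ littleCrossNumber (∀ i : Fin r, ZMod (n i)) := by
    refine le_csSup ⟨∑ i, (l i : ℝ) + ε / 2, ?_⟩ ⟨S, hS, rfl⟩
    rintro x ⟨T, hT, rfl⟩
    exact hupper T hT
  have hL0 : 0 ≤ ∑ i, (l i : ℝ) := by positivity
  have hK0 : (0 : ℝ) < K := lt_of_le_of_lt (by positivity) hK
  have hlower : (∑ i, (l i : ℝ)) * (1 - 1 / K) ≤ crossNumber S := by
    rw [hSc, Finset.sum_mul]
    refine Finset.sum_le_sum fun i _ => ?_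
    rw [← hl' i, ← nsmul_eq_mul]
    refine Finset.card_nsmul_le_sum _ _ _ fun p hp => ?_
    have hKp : (K : ℝ) ≤ p := by
      exact_mod_cast (le_max_right M K).trans
        (hbig p (Nat.primeFactors_mono (hnN i) (hn0 _) hp))
    have := one_div_le_one_div_of_le hK0 hKp
    linarith
  have hsmall : (∑ i, (l i : ℝ)) * (1 / K) < ε := by
    rw [mul_one_div, div_lt_iff₀ hK0]
    rw [div_lt_iff₀ hε] at hK
    linarith
  rw [abs_lt]
  constructor <;> linarith
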